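/- arXiv:1805.05998 — 2 statements merged into one kernel-verified Lean document; each statement's English description precedes it below -/
import Mathlib

section
/- Let A be a separable unital C*-algebra and K ⊆ A a compact generating set. Then the metric space (Rep(A), d_K) is complete: every sequence (π_n) in Rep(A) that is Cauchy with respect to d_K converges with respect to d_K to some π ∈ Rep(A). -/
noncomputable section

abbrev H2 : Type := lp (fun _ : ℕ => ℂ) 2
abbrev BH : Type := H2 →L[ℂ] H2

abbrev RepSp (A : Type*) [CStarAlgebra A] := A →⋆ₐ[ℂ] BH

def Generates {A : Type*} [CStarAlgebra A] (K : Set A) : Prop :=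
  (StarAlgebra.adjoin ℂ K).topologicalClosure = ⊤

def dRep {A : Type*} [CStarAlgebra A] (K : Set A) (π₁ π₂ : RepSp A) : ℝ :=
  ⨆ a ∈ K, ‖π₁ a - π₂ a‖

open Filter Topology

section

variable {A : Type*} [CStarAlgebra A]

theorem norm_sub_apply_le_dRep {K : Set A} (hK : IsCompact K) (π₁ π₂ : RepSp A) {a : A}
    (ha : a ∈ K) : ‖π₁ a - π₂ a‖ ≤ dRep K π₁ π₂ := by
  obtain ⟨C, hC⟩ := hK.isBounded.exists_norm_le
  have hC0 : 0 ≤ C := (norm_nonneg a).trans (hC a ha)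
  have hbdd : BddAbove (Set.range fun x => ⨆ _ : x ∈ K, ‖π₁ x - π₂ x‖) := by
    refine ⟨C + C, ?_⟩
    rintro _ ⟨x, rfl⟩
    refine Real.iSup_le (fun hx => ?_) (by positivity)
    exact (norm_sub_le _ _).trans (add_le_add
      ((NonUnitalStarAlgHom.norm_apply_le π₁ x).trans (hC x hx))
      ((NonUnitalStarAlgHom.norm_apply_le π₂ x).trans (hC x hx)))
  refine le_trans ?_ (le_ciSup hbdd a)
  simp [ha]

theorem dRep_nonneg (K : Set A) (π₁ π₂ : RepSp A) : 0 ≤ dRep K π₁ π₂ :=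
  Real.iSup_nonneg fun _ => Real.iSup_nonneg fun _ => norm_nonneg _

theorem dRep_le {K : Set A} {π₁ π₂ : RepSp A} {C : ℝ} (hC : 0 ≤ C)
    (h : ∀ a ∈ K, ‖π₁ a - π₂ a‖ ≤ C) : dRep K π₁ π₂ ≤ C :=
  Real.iSup_le (fun a => Real.iSup_le (h a) hC) hC

/-- The elements at which a sequence of representations converges in norm. -/
def convergenceSubalgebra (π : ℕ → RepSp A) : StarSubalgebra ℂ A where
  carrier := {a | ∃ b, Tendsto (fun n => π n a) atTop (𝓝 b)}
  mul_mem' := by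
    rintro x y ⟨b, hb⟩ ⟨c, hc⟩
    exact ⟨b * c, by simpa only [map_mul] using hb.mul hc⟩
  add_mem' := by
    rintro x y ⟨b, hb⟩ ⟨c, hc⟩
    exact ⟨b + c, by simpa only [map_add] using hb.add hc⟩
  algebraMap_mem' r := ⟨algebraMap ℂ BH r, by
    simpa only [AlgHomClass.commutes] using tendsto_const_nhds⟩
  star_mem' := by
    rintro x ⟨b, hb⟩
    exact ⟨star b, by simpa only [map_star] using hb.star⟩

theorem isClosed_convergenceSubalgebra (π : ℕ → RepSp A) :
    IsClosed (convergenceSubalgebra π : Set A) := by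
  refine isClosed_of_closure_subset fun a ha => ?_
  refine cauchySeq_tendsto_of_complete (Metric.cauchySeq_iff.2 fun ε hε => ?_)
  obtain ⟨b, ⟨c, hc⟩, hab⟩ := Metric.mem_closure_iff.1 ha (ε / 3) (by positivity)
  obtain ⟨N, hN⟩ := Metric.cauchySeq_iff.1 hc.cauchySeq (ε / 3) (by positivity)
  have key (n : ℕ) : dist (π n a) (π n b) < ε / 3 := by
    rw [dist_eq_norm, ← map_sub]
    exact (NonUnitalStarAlgHom.norm_apply_le (π n) (a - b)).trans_lt (by rwa [← dist_eq_norm])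
  refine ⟨N, fun m hm n hn => ?_⟩
  have h₁ := dist_triangle4_right (π m a) (π n a) (π m b) (π n b)
  linarith [key m, key n, hN m hm n hn]

theorem exists_pointwise_limit (π : ℕ → RepSp A)
    (h : ∀ a, ∃ b, Tendsto (fun n => π n a) atTop (𝓝 b)) :
    ∃ π₀ : RepSp A, ∀ a, Tendsto (fun n => π n a) atTop (𝓝 (π₀ a)) := by
  choose f hf using h
  refine ⟨{ toFun := f
            map_one' := tendsto_nhds_unique (hf 1) (by
              simpa only [map_one] using tendsto_const_nhds)
            map_mul' := fun x y => tendsto_nhds_unique (hf (x * y)) (by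
              simpa only [map_mul] using (hf x).mul (hf y))
            map_zero' := tendsto_nhds_unique (hf 0) (by
              simpa only [map_zero] using tendsto_const_nhds)
            map_add' := fun x y => tendsto_nhds_unique (hf (x + y)) (by
              simpa only [map_add] using (hf x).add (hf y))
            commutes' := fun r => tendsto_nhds_unique (hf _) (by
              simpa only [AlgHomClass.commutes] using tendsto_const_nhds)
            map_star' := fun x => tendsto_nhds_unique (hf (star x)) (by
              simpa only [map_star] using (hf x).star) }, hf⟩

end

theorem stmt2 (A : Type*) [CStarAlgebra A] [TopologicalSpace.SeparableSpace A]
    (K : Set A) (hK : IsCompact K) (hgen : Generates K)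
    (π : ℕ → RepSp A)
    (hcauchy : ∀ ε > (0 : ℝ), ∃ N : ℕ, ∀ m ≥ N, ∀ n ≥ N, dRep K (π m) (π n) < ε) :
    ∃ π₀ : RepSp A,
      Filter.Tendsto (fun n => dRep K (π n) π₀) Filter.atTop (nhds 0) := by
  have hKconv : K ⊆ convergenceSubalgebra π := fun a ha => by
    refine cauchySeq_tendsto_of_complete (Metric.cauchySeq_iff.2 fun ε hε => ?_)
    obtain ⟨N, hN⟩ := hcauchy ε hε
    refine ⟨N, fun m hm n hn => ?_⟩
    rw [dist_eq_norm]
    exact (norm_sub_apply_le_dRep hK _ _ ha).trans_lt (hN m hm n hn)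
  have htop : ⊤ ≤ convergenceSubalgebra π := by
    rw [← hgen]
    exact StarSubalgebra.topologicalClosure_minimal (StarAlgebra.adjoin_le hKconv)
      (isClosed_convergenceSubalgebra π)
  obtain ⟨π₀, hπ₀⟩ := exists_pointwise_limit π fun a => htop (show a ∈ ⊤ from trivial)
  refine ⟨π₀, Metric.tendsto_atTop.2 fun ε hε => ?_⟩
  obtain ⟨N, hN⟩ := hcauchy (ε / 2) (by positivity)
  refine ⟨N, fun n hn => ?_⟩
  rw [Real.dist_0_eq_abs, abs_of_nonneg (dRep_nonneg K _ _)]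
  refine (dRep_le (half_pos hε).le fun a ha => ?_).trans_lt (half_lt_self hε)
  refine le_of_tendsto (tendsto_const_nhds.sub (hπ₀ a)).norm ?_
  filter_upwards [eventually_ge_atTop N] with m hm
  exact (norm_sub_apply_le_dRep hK _ _ ha).trans (hN n hn m hm).le
end
end

section
/- Let H be an infinite-dimensional complex Hilbert space and T ∈ B(H) a bounded linear operator. Then the closure in the operator norm of the unitary orbit Orb(T) := {U T U⁻¹ : U a unitary operator on H} is compact if and only if there exists λ ∈ ℂ such that T = λ·Id. -/
noncomputable section

/-- The unitary orbit of an operator `T`. -/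
def unitaryOrbit {H : Type*} [NormedAddCommGroup H] [InnerProductSpace ℂ H]
    [CompleteSpace H] (T : H →L[ℂ] H) : Set (H →L[ℂ] H) :=
  {S | ∃ U ∈ unitary (H →L[ℂ] H), S = U * T * star U}

/-- For orthogonal vectors `y` and `z` of equal norm, the reflection in the orthogonal complement
of `y - z` sends `y` to `z`. -/
theorem reflection_orthogonal_span_sub_apply {H : Type*} [NormedAddCommGroup H]
    [InnerProductSpace ℂ H] {y z : H} (hyz : inner ℂ y z = 0) (hn : ‖y‖ = ‖z‖) :
    (ℂ ∙ (y - z))ᗮ.reflection y = z := by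
  have hsub := Submodule.reflection_orthogonalComplement_singleton_eq_neg (𝕜 := ℂ) (y - z)
  have hadd : (ℂ ∙ (y - z))ᗮ.reflection (y + z) = y + z := by
    apply Submodule.reflection_mem_subspace_eq_self
    rw [Submodule.mem_orthogonal_singleton_iff_inner_right, inner_sub_left, inner_add_right,
      inner_add_right, hyz, inner_eq_zero_symm.mp hyz, inner_self_eq_norm_sq_to_K,
      inner_self_eq_norm_sq_to_K, hn]
    ring
  rw [map_sub] at hsub
  rw [map_add] at hadd
  have h2 : (2 : ℂ) • (ℂ ∙ (y - z))ᗮ.reflection y = (2 : ℂ) • z := by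
    rw [two_smul, two_smul]
    calc _ = ((ℂ ∙ (y - z))ᗮ.reflection y + (ℂ ∙ (y - z))ᗮ.reflection z)
          + ((ℂ ∙ (y - z))ᗮ.reflection y - (ℂ ∙ (y - z))ᗮ.reflection z) := by abel
      _ = z + z := by rw [hsub, hadd]; abel
  exact smul_right_injective H two_ne_zero h2

/-- If `T x = a • x + y` with `y` orthogonal to `x`, then some operator in the unitary orbit of `T`
sends `x` to `a • x + z`, for any `z` orthogonal to `x` and `y` with the norm of `y`. -/
theorem exists_mem_unitaryOrbit_apply_eq {H : Type*} [NormedAddCommGroup H]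
    [InnerProductSpace ℂ H] [CompleteSpace H] {T : H →L[ℂ] H} {x y z : H} {a : ℂ}
    (hT : T x = a • x + y) (hxy : inner ℂ x y = 0) (hxz : inner ℂ x z = 0)
    (hyz : inner ℂ y z = 0) (hn : ‖y‖ = ‖z‖) :
    ∃ S ∈ unitaryOrbit T, S x = a • x + z := by
  let U := Unitary.linearIsometryEquiv.symm (ℂ ∙ (y - z))ᗮ.reflection
  have hUx : (U : H →L[ℂ] H) x = x := by
    change (ℂ ∙ (y - z))ᗮ.reflection x = x
    apply Submodule.reflection_mem_subspace_eq_self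
    rw [Submodule.mem_orthogonal_singleton_iff_inner_left, inner_sub_right, hxy, hxz, sub_zero]
  have hUy : (U : H →L[ℂ] H) y = z := reflection_orthogonal_span_sub_apply hyz hn
  have hUx' : star (U : H →L[ℂ] H) x = x := by
    conv_lhs => rw [← hUx]
    exact DFunLike.congr_fun (Unitary.star_mul_self_of_mem U.2) x
  refine ⟨_, ⟨U, U.2, rfl⟩, ?_⟩
  change (U : H →L[ℂ] H) (T (star (U : H →L[ℂ] H) x)) = _
  rw [hUx', hT, map_add, map_smul, hUx, hUy]

/-- A normed space with a compact sphere of positive radius is finite-dimensional. -/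
theorem finiteDimensional_of_isCompact_sphere {E : Type*} [NormedAddCommGroup E]
    [NormedSpace ℂ E] {r : ℝ} (hr : 0 < r) (hS : IsCompact (Metric.sphere (0 : E) r)) :
    FiniteDimensional ℂ E := by
  rcases subsingleton_or_nontrivial E with _ | _
  · infer_instance
  have hball : IsCompact (Metric.closedBall (0 : E) r) := by
    refine (((isCompact_closedBall (0 : ℂ) 1).prod hS).image
      (continuous_fst.smul continuous_snd)).of_isClosed_subset Metric.isClosed_closedBall ?_
    intro v hv
    rw [mem_closedBall_zero_iff] at hv
    obtain rfl | hv0 := eq_or_ne v 0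
    · obtain ⟨w, hw⟩ := NormedSpace.sphere_nonempty (x := (0 : E)).mpr hr.le
      exact ⟨(0, w), ⟨by simp, hw⟩, by simp⟩
    have hv0' : ‖v‖ ≠ 0 := norm_ne_zero_iff.mpr hv0
    refine ⟨(((‖v‖ / r : ℝ) : ℂ), ((r / ‖v‖ : ℝ) : ℂ) • v), ⟨?_, ?_⟩, ?_⟩
    · rw [mem_closedBall_zero_iff, Complex.norm_real, Real.norm_of_nonneg (by positivity)]
      exact (div_le_one hr).mpr hv
    · rw [mem_sphere_zero_iff_norm, norm_smul, Complex.norm_real,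
        Real.norm_of_nonneg (by positivity), div_mul_cancel₀ _ hv0']
    · have h1 : ‖v‖ / r * (r / ‖v‖) = 1 := by field_simp
      change ((‖v‖ / r : ℝ) : ℂ) • ((r / ‖v‖ : ℝ) : ℂ) • v = v
      rw [smul_smul, ← Complex.ofReal_mul, h1, Complex.ofReal_one, one_smul]
  exact FiniteDimensional.of_isCompact_closedBall₀ ℂ hr hball

theorem finiteDimensional_of_orthogonal {H : Type*} [NormedAddCommGroup H]
    [InnerProductSpace ℂ H] (K : Submodule ℂ H) [FiniteDimensional ℂ K]
    [FiniteDimensional ℂ Kᗮ] : FiniteDimensional ℂ H := by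
  have h : FiniteDimensional ℂ (K ⊔ Kᗮ : Submodule ℂ H) := inferInstance
  rw [Submodule.sup_orthogonal_of_hasOrthogonalProjection] at h
  exact Module.finite_def.mpr (Module.Finite.iff_fg.mp h)

theorem finiteDimensional_of_isCompact_closure_unitaryOrbit {H : Type*} [NormedAddCommGroup H]
    [InnerProductSpace ℂ H] [CompleteSpace H] {T : H →L[ℂ] H} {x : H}
    (hT : IsCompact (closure (unitaryOrbit T))) (hx : LinearIndependent ℂ ![x, T x]) :
    FiniteDimensional ℂ H := by
  obtain ⟨a, ha⟩ := Submodule.mem_span_singleton.mp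
    ((ℂ ∙ x).starProjection_apply_mem (T x))
  obtain ⟨y, hy⟩ : ∃ y, y = T x - a • x := ⟨_, rfl⟩
  have hTx : T x = a • x + y := by rw [hy]; abel
  have hxy : inner ℂ x y = 0 := by
    rw [← Submodule.mem_orthogonal_singleton_iff_inner_right, hy, ha]
    exact (ℂ ∙ x).sub_starProjection_mem_orthogonal (T x)
  have hy0 : y ≠ 0 := fun h ↦ by
    have := (LinearIndependent.pair_iff.mp hx) a (-1) (by rw [hTx, h]; simp)
    simp at this
  let K : Submodule ℂ H := Submodule.span ℂ {x, y}
  have : FiniteDimensional ℂ K := FiniteDimensional.span_of_finite ℂ (by simp)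
  have hxK : x ∈ K := Submodule.subset_span (by simp)
  have hyK : y ∈ K := Submodule.subset_span (by simp)
  have hemb : Topology.IsClosedEmbedding (fun z : Kᗮ ↦ a • x + (z : H)) :=
    (Homeomorph.addLeft (a • x)).isClosedEmbedding.comp
      K.isClosed_orthogonal.isClosedEmbedding_subtypeVal
  have hcomp := hemb.isCompact_preimage
    (hT.image (f := fun S : H →L[ℂ] H ↦ S x) (by fun_prop))
  have hsphere : IsCompact (Metric.sphere (0 : Kᗮ) ‖y‖) := by
    refine hcomp.of_isClosed_subset Metric.isClosed_sphere fun z hz ↦ ?_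
    obtain ⟨S, hS, hSx⟩ := exists_mem_unitaryOrbit_apply_eq hTx hxy
      (K.inner_right_of_mem_orthogonal hxK z.2) (K.inner_right_of_mem_orthogonal hyK z.2)
      (mem_sphere_zero_iff_norm.mp hz).symm
    exact ⟨S, subset_closure hS, hSx⟩
  have := finiteDimensional_of_isCompact_sphere (norm_pos_iff.mpr hy0) hsphere
  exact finiteDimensional_of_orthogonal K

theorem stmt14 (H : Type*) [NormedAddCommGroup H] [InnerProductSpace ℂ H]
    [CompleteSpace H] (hdim : ¬ FiniteDimensional ℂ H) (T : H →L[ℂ] H) :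
    IsCompact (closure (unitaryOrbit T)) ↔ ∃ c : ℂ, T = c • (1 : H →L[ℂ] H) := by
  constructor
  · intro hT
    obtain ⟨c, hc⟩ := LinearMap.exists_eq_smul_id_of_forall_notLinearIndependent
      (f := (T : H →ₗ[ℂ] H)) fun x hx ↦
        hdim (finiteDimensional_of_isCompact_closure_unitaryOrbit hT hx)
    exact ⟨c, ContinuousLinearMap.ext fun x ↦ DFunLike.congr_fun hc x⟩
  · rintro ⟨c, rfl⟩
    have hsub : unitaryOrbit (c • (1 : H →L[ℂ] H)) ⊆ {c • 1} := by
      rintro S ⟨U, hU, rfl⟩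
      simp [Unitary.mul_star_self_of_mem hU]
    exact isCompact_singleton.of_isClosed_subset isClosed_closure
      (closure_minimal hsub isClosed_singleton)
end
end
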